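/- For every integer p ≥ 3, let G be the graph obtained from the complete graph K_5 by subdividing each of its edges exactly p times. Then there exists a vertex v of G such that G − v is planar, but G cannot be contracted to a planar graph by using fewer than p − 1 edge contractions. -/

import Mathlib

open SimpleGraph

/-- A bundled finite simple graph. -/
structure FinGraph where
  V : Type
  [finV : Finite V]
  G : SimpleGraph V

attribute [instance] FinGraph.finV

/-- The bundled version of a finite simple graph. -/
def FinGraph.of (V : Type) [Finite V] (G : SimpleGraph V) : FinGraph := ⟨V, G⟩

/-- `H` is (an isomorphic copy of) the graph obtained from `G` by contracting the edge `uv`: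
there is a surjection `f` identifying exactly `u` and `v`, with `H` having precisely the
images of edges of `G` as edges. -/
def IsEdgeContractionOf {V W : Type} (G : SimpleGraph V) (u v : V) (H : SimpleGraph W) : Prop :=
  G.Adj u v ∧ ∃ f : V → W, f u = f v ∧ Function.Surjective f ∧
    (∀ a b : V, a ≠ b → f a = f b → (a = u ∧ b = v) ∨ (a = v ∧ b = u)) ∧
    (∀ x y : W, H.Adj x y ↔ x ≠ y ∧ ∃ a b : V, f a = x ∧ f b = y ∧ G.Adj a b)

/-- `B` is obtained from `A` by contracting one edge. -/
def ContractionStep (A B : FinGraph) : Prop :=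
  ∃ u v : A.V, IsEdgeContractionOf A.G u v B.G

/-- `B` is obtained from `A` by at most `k` edge contractions. -/
def ContractsInAtMost (k : ℕ) (A B : FinGraph) : Prop :=
  ∃ n : ℕ, n ≤ k ∧ ∃ c : ℕ → FinGraph, c 0 = A ∧ c n = B ∧
    ∀ i, i < n → ContractionStep (c i) (c (i + 1))

/-- `B` is a contraction of `A`, i.e. `B` can be obtained (up to isomorphism) from `A`
by a sequence of edge contractions. -/
def IsContraction (A B : FinGraph) : Prop :=
  ∃ C : FinGraph, Relation.ReflTransGen ContractionStep A C ∧ Nonempty (C.G ≃g B.G)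

/-- `B` is obtained from `A` by deleting one edge. -/
def EdgeDeletionStep (A B : FinGraph) : Prop :=
  ∃ e : Sym2 A.V, e ∈ A.G.edgeSet ∧ Nonempty (B.G ≃g A.G.deleteEdges {e})

/-- `B` is obtained from `A` by deleting one vertex. -/
def VertexDeletionStep (A B : FinGraph) : Prop :=
  ∃ v : A.V, Nonempty (B.G ≃g A.G.induce {x : A.V | x ≠ v})

/-- One minor operation: an edge contraction, an edge deletion or a vertex deletion. -/
def MinorStep (A B : FinGraph) : Prop :=
  ContractionStep A B ∨ EdgeDeletionStep A B ∨ VertexDeletionStep A B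

/-- `A` contains `B` as a minor: `A` can be modified to (an isomorphic copy of) `B` by a
sequence of edge contractions, edge deletions and vertex deletions. -/
def HasMinor (A B : FinGraph) : Prop :=
  ∃ C : FinGraph, Relation.ReflTransGen MinorStep A C ∧ Nonempty (C.G ≃g B.G)

/-- The complete graph on five vertices, bundled. -/
def K5 : FinGraph := FinGraph.of (Fin 5) ⊤

/-- The complete bipartite graph `K_{3,3}`, bundled. -/
def K33 : FinGraph := FinGraph.of (Fin 3 ⊕ Fin 3) (completeBipartiteGraph (Fin 3) (Fin 3))

/-- A finite graph is planar iff (by Kuratowski's theorem) it has no `K₅` and no `K_{3,3}`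
minor. -/
def FinGraph.IsPlanar (A : FinGraph) : Prop := ¬ HasMinor A K5 ∧ ¬ HasMinor A K33

/-- `A` can be contracted to a planar graph using at most `k` edge contractions. -/
def ContractiblePlanar (k : ℕ) (A : FinGraph) : Prop :=
  ∃ B : FinGraph, ContractsInAtMost k A B ∧ B.IsPlanar

/-- `P` is an `H`-witness structure of `G`: a partition of `V(G)` into nonempty connected
pieces `P x`, one for each vertex `x` of `H`, such that distinct pieces are adjacent iff the
corresponding vertices of `H` are adjacent. -/
def IsWitnessStructure {V X : Type} (G : SimpleGraph V) (H : SimpleGraph X)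
    (P : X → Set V) : Prop :=
  (∀ x : X, (P x).Nonempty) ∧
  (∀ x y : X, x ≠ y → Disjoint (P x) (P y)) ∧
  (∀ v : V, ∃ x : X, v ∈ P x) ∧
  (∀ x : X, (G.induce (P x)).Connected) ∧
  (∀ x y : X, x ≠ y → (H.Adj x y ↔ ∃ a ∈ P x, ∃ b ∈ P y, G.Adj a b))

/-- `uv` is a witness edge: an edge of `G` whose end-vertices belong to two different
witness sets of `P`. -/
def IsWitnessEdge {V X : Type} (G : SimpleGraph V) (P : X → Set V) (u v : V) : Prop :=
  G.Adj u v ∧ ¬ ∃ x : X, u ∈ P x ∧ v ∈ P x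

/-- Index type for the ten edges of `K₅`: ordered pairs `(i, j)` with `i < j`. -/
abbrev K5Edge : Type := {q : Fin 5 × Fin 5 // q.1 < q.2}

/-- The graph obtained from `K₅` by subdividing each edge exactly `p` times: for the edge
`{i, j}` (with `i < j`) we have the internal path vertices `(⟨(i,j),_⟩, 0), …, (⟨(i,j),_⟩, p-1)`,
forming a path from `i` to `j`; the original edges of `K₅` are gone. -/
def SubdividedK5 (p : ℕ) : SimpleGraph (Fin 5 ⊕ K5Edge × Fin p) :=
  SimpleGraph.fromRel (fun a b =>
    match a, b with
    | Sum.inl i, Sum.inr (e, t) => (i = e.val.1 ∧ (t : ℕ) = 0) ∨ (i = e.val.2 ∧ (t : ℕ) = p - 1)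
    | Sum.inr (e, t), Sum.inr (e', t') => e = e' ∧ (t' : ℕ) = (t : ℕ) + 1
    | _, _ => False)


/-! ### Sparsity, an invariant that bounds the cycle rank -/

/-- Every vertex set `U` spans at most `|U| + 2` edges. -/
def Sparse {V : Type} (G : SimpleGraph V) : Prop :=
  ∀ (U : Finset V) (F : Finset (Sym2 V)),
    (∀ e ∈ F, e ∈ G.edgeSet ∧ ∀ x ∈ e, x ∈ U) → F.card ≤ U.card + 2

lemma Sparse.of_hom {V W : Type} {G : SimpleGraph V} {H : SimpleGraph W} (hG : Sparse G)
    (f : W → V) (hf : Function.Injective f) (hadj : ∀ a b, H.Adj a b → G.Adj (f a) (f b)) :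
    Sparse H := by
  classical
  intro U F hF
  have h := hG (U.image f) (F.image (Sym2.map f)) (by
    intro e he
    obtain ⟨e', he', rfl⟩ := Finset.mem_image.1 he
    obtain ⟨h1, h2⟩ := hF e' he'
    induction e' with
    | _ a b =>
      simp only [Sym2.map_mk, SimpleGraph.mem_edgeSet] at *
      refine ⟨hadj _ _ h1, ?_⟩
      intro x hx
      rw [Sym2.mem_iff] at hx
      rcases hx with rfl | rfl
      · exact Finset.mem_image_of_mem _ (h2 a (by simp))
      · exact Finset.mem_image_of_mem _ (h2 b (by simp)))
  rwa [Finset.card_image_of_injective _ hf,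
    Finset.card_image_of_injective _ (Sym2.map.injective hf)] at h

lemma Sparse.contract {V W : Type} [Finite V] {G : SimpleGraph V} {H : SimpleGraph W}
    (hG : Sparse G) (u v : V) (h : IsEdgeContractionOf G u v H) : Sparse H := by
  classical
  have := Fintype.ofFinite V
  obtain ⟨huv, f, hfuv, hsurj, hinj, hadj⟩ := h
  intro U F hF
  have hlift : ∀ e : Sym2 W, ∃ e' : Sym2 V, e ∈ F → e' ∈ G.edgeSet ∧ Sym2.map f e' = e := by
    intro e
    by_cases he : e ∈ F
    · obtain ⟨h1, -⟩ := hF e he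
      induction e with
      | _ x y =>
        rw [SimpleGraph.mem_edgeSet, hadj] at h1
        obtain ⟨-, a, b, rfl, rfl, hab⟩ := h1
        exact ⟨s(a, b), fun _ => ⟨hab, rfl⟩⟩
    · exact ⟨s(u, u), fun h => absurd h he⟩
  choose l hl using hlift
  have hlinj : (F.image l).card = F.card := by
    apply Finset.card_image_of_injOn
    intro a ha b hb hab
    rw [← (hl a ha).2, ← (hl b hb).2, hab]
  have hnot : s(u, v) ∉ F.image l := by
    intro hmem
    obtain ⟨e, he, hee⟩ := Finset.mem_image.1 hmem
    have h2 := (hl e he).2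
    rw [hee, Sym2.map_mk, hfuv] at h2
    have h1 := (hF e he).1
    rw [← h2, SimpleGraph.mem_edgeSet] at h1
    exact H.loopless.irrefl _ h1
  set U' : Finset V := Finset.univ.filter (fun x => f x ∈ U) with hU'
  have hcov : ∀ e ∈ F.image l, e ∈ G.edgeSet ∧ ∀ x ∈ e, x ∈ U' := by
    intro e' he'
    obtain ⟨e, he, rfl⟩ := Finset.mem_image.1 he'
    refine ⟨(hl e he).1, fun x hx => ?_⟩
    simp only [hU', Finset.mem_filter, Finset.mem_univ, true_and]
    apply (hF e he).2
    rw [← (hl e he).2]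
    exact Sym2.mem_map.2 ⟨x, hx, rfl⟩
  have hcard : (U'.erase v).card ≤ U.card := by
    apply Finset.card_le_card_of_injOn f
    · intro x hx
      simp [hU'] at hx
      exact hx.1
    · intro a ha b hb hab
      by_contra hne
      rcases hinj a b hne hab with ⟨rfl, rfl⟩ | ⟨rfl, rfl⟩ <;> simp at ha hb
  by_cases hu : f u ∈ U
  · have huU : u ∈ U' := by simp [hU', hu]
    have hvU : v ∈ U' := by simp [hU', ← hfuv, hu]
    have := hG U' (insert s(u, v) (F.image l)) (by
      intro e he
      rcases Finset.mem_insert.1 he with rfl | he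
      · refine ⟨huv, fun x hx => ?_⟩
        rw [Sym2.mem_iff] at hx
        rcases hx with rfl | rfl <;> assumption
      · exact hcov e he)
    rw [Finset.card_insert_of_notMem hnot, hlinj] at this
    rw [Finset.card_erase_of_mem hvU] at hcard
    omega
  · have hvU : v ∉ U' := by simp [hU', ← hfuv, hu]
    have := hG U' (F.image l) hcov
    rw [Finset.erase_eq_of_notMem hvU] at hcard
    omega

lemma Sparse.step {A B : FinGraph} (hA : Sparse A.G) (h : MinorStep A B) : Sparse B.G := by
  rcases h with ⟨u, v, h⟩ | ⟨e, -, ⟨i⟩⟩ | ⟨v, ⟨i⟩⟩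
  · exact hA.contract u v h
  · refine hA.of_hom i i.injective fun a b hab => ?_
    have := i.map_rel_iff.2 hab
    rw [SimpleGraph.deleteEdges_adj] at this
    exact this.1
  · refine hA.of_hom (fun x => (i x).1) (fun a b hab => i.injective (Subtype.ext hab))
      fun a b hab => ?_
    exact i.map_rel_iff.2 hab

lemma Sparse.hasMinor {A B : FinGraph} (hA : Sparse A.G) (h : HasMinor A B) : Sparse B.G := by
  obtain ⟨C, hC, ⟨i⟩⟩ := h
  have hCs : Sparse C.G := by
    clear i
    induction hC with
    | refl => exact hA
    | tail _ hs ih => exact ih.step hs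
  exact hCs.of_hom i.symm i.symm.injective fun a b hab => i.symm.map_rel_iff.2 hab

lemma not_sparse_K5 : ¬ Sparse K5.G := by
  show ¬ Sparse (⊤ : SimpleGraph (Fin 5))
  intro h
  have := h (Finset.univ : Finset (Fin 5))
    ((Finset.univ : Finset (Fin 5 × Fin 5)).filter (fun q => q.1 < q.2) |>.image
      (fun q => s(q.1, q.2))) (by
    intro e he
    obtain ⟨q, hq, rfl⟩ := Finset.mem_image.1 he
    refine ⟨?_, fun x _ => Finset.mem_univ _⟩
    have : q.1 < q.2 := (Finset.mem_filter.1 hq).2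
    show (⊤ : SimpleGraph (Fin 5)).Adj q.1 q.2
    exact this.ne)
  revert this
  decide

lemma not_sparse_K33 : ¬ Sparse K33.G := by
  show ¬ Sparse (completeBipartiteGraph (Fin 3) (Fin 3))
  intro h
  have := h (Finset.univ : Finset (Fin 3 ⊕ Fin 3))
    ((Finset.univ : Finset (Fin 3 × Fin 3)).image
      (fun q => s(Sum.inl q.1, Sum.inr q.2))) (by
    intro e he
    obtain ⟨q, hq, rfl⟩ := Finset.mem_image.1 he
    refine ⟨?_, fun x _ => Finset.mem_univ _⟩
    show (completeBipartiteGraph (Fin 3) (Fin 3)).Adj _ _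
    simp)
  revert this
  decide

/-! ### The subdivided paths -/

/-- The `t`-th vertex on the path replacing the edge `e`. -/
def pathV (p : ℕ) (e : K5Edge) (t : ℕ) : Fin 5 ⊕ K5Edge × Fin p :=
  if t = 0 then Sum.inl e.val.1
  else if h : t - 1 < p then Sum.inr (e, ⟨t - 1, h⟩) else Sum.inl e.val.2

lemma pathV_zero (p : ℕ) (e : K5Edge) : pathV p e 0 = Sum.inl e.val.1 := rfl

lemma pathV_succ (p : ℕ) (e : K5Edge) (t : Fin p) :
    pathV p e (t + 1) = Sum.inr (e, t) := by
  simp [pathV]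

lemma pathV_succ' (p : ℕ) (e : K5Edge) (t : ℕ) (h : t < p) :
    pathV p e (t + 1) = Sum.inr (e, ⟨t, h⟩) := by
  simp [pathV, h]

lemma pathV_last (p : ℕ) (e : K5Edge) : pathV p e (p + 1) = Sum.inl e.val.2 := by
  simp [pathV]

lemma adj_iff_pathV (p : ℕ) (hp : 3 ≤ p) (a b : Fin 5 ⊕ K5Edge × Fin p)
    (h : (SubdividedK5 p).Adj a b) :
    ∃ e : K5Edge, ∃ t ≤ p, (a = pathV p e t ∧ b = pathV p e (t + 1)) ∨
      (b = pathV p e t ∧ a = pathV p e (t + 1)) := by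
  have key : ∀ (i : Fin 5) (e : K5Edge) (t : Fin p),
      (i = e.val.1 ∧ (t : ℕ) = 0) ∨ (i = e.val.2 ∧ (t : ℕ) = p - 1) →
      ∃ e' : K5Edge, ∃ t' ≤ p,
        ((Sum.inl i : Fin 5 ⊕ K5Edge × Fin p) = pathV p e' t' ∧
          Sum.inr (e, t) = pathV p e' (t' + 1)) ∨
        (Sum.inr (e, t) = pathV p e' t' ∧
          (Sum.inl i : Fin 5 ⊕ K5Edge × Fin p) = pathV p e' (t' + 1)) := by
    rintro i e t (⟨rfl, ht⟩ | ⟨rfl, ht⟩)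
    · refine ⟨e, 0, by omega, Or.inl ⟨rfl, ?_⟩⟩
      rw [← pathV_succ, ht]
    · refine ⟨e, p, le_rfl, Or.inr ⟨?_, (pathV_last p e).symm⟩⟩
      rw [← pathV_succ, ht]
      congr 1
      omega
  have key2 : ∀ (e e' : K5Edge) (t t' : Fin p), e = e' ∧ (t' : ℕ) = (t : ℕ) + 1 →
      ∃ e₀ : K5Edge, ∃ t₀ ≤ p, (Sum.inr (e, t) = pathV p e₀ t₀ ∧
          Sum.inr (e', t') = pathV p e₀ (t₀ + 1)) := by
    rintro e e' t t' ⟨rfl, ht⟩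
    refine ⟨e, t + 1, by omega, ?_, ?_⟩
    · rw [pathV_succ]
    · rw [← pathV_succ, ht]
  unfold SubdividedK5 at h
  rw [SimpleGraph.fromRel_adj] at h
  obtain ⟨-, h⟩ := h
  rcases a with i | ⟨e, t⟩ <;> rcases b with j | ⟨e', t'⟩
  · simp at h
  · simp only [or_false] at h
    exact key i e' t' h
  · simp only [false_or] at h
    obtain ⟨e', t', h1, h2⟩ := key j e t h
    exact ⟨e', t', h1, h2.symm⟩
  · rcases h with h | h
    · obtain ⟨e₀, t₀, h1, h2⟩ := key2 _ _ _ _ h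
      exact ⟨e₀, t₀, h1, Or.inl h2⟩
    · obtain ⟨e₀, t₀, h1, h2⟩ := key2 _ _ _ _ h
      exact ⟨e₀, t₀, h1, Or.inr h2⟩

lemma pathV_adj (p : ℕ) (hp : 3 ≤ p) (e : K5Edge) (t : ℕ) (ht : t ≤ p) :
    (SubdividedK5 p).Adj (pathV p e t) (pathV p e (t + 1)) := by
  unfold SubdividedK5
  rw [SimpleGraph.fromRel_adj]
  rcases Nat.eq_zero_or_pos t with rfl | h0
  · rw [pathV_zero, pathV_succ' p e 0 (by omega)]
    simp
  · obtain ⟨s, rfl⟩ : ∃ s, t = s + 1 := ⟨t - 1, by omega⟩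
    rw [pathV_succ' p e s (by omega)]
    rcases Nat.lt_or_ge (s + 1) p with h | h
    · rw [pathV_succ' p e (s + 1) h]
      simp
    · obtain rfl : p = s + 1 := by omega
      rw [pathV_last]
      simp

lemma pathV_injOn (p : ℕ) (e : K5Edge) (s t : ℕ) (hs : s ≤ p + 1) (ht : t ≤ p + 1)
    (h : pathV p e s = pathV p e t) : s = t := by
  have hne : e.val.1 ≠ e.val.2 := e.property.ne
  have hcases : ∀ s ≤ p + 1, s = 0 ∨ s = p + 1 ∨ ∃ r, ∃ _ : r < p, s = r + 1 := by
    intro s hs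
    rcases Nat.eq_zero_or_pos s with h | h
    · exact Or.inl h
    · rcases Nat.lt_or_ge s (p + 1) with h' | h'
      · exact Or.inr (Or.inr ⟨s - 1, by omega, by omega⟩)
      · exact Or.inr (Or.inl (by omega))
  rcases hcases s hs with rfl | rfl | ⟨r, hr, rfl⟩ <;>
    rcases hcases t ht with rfl | rfl | ⟨r', hr', rfl⟩ <;>
    simp_all [pathV_zero, pathV_last, pathV_succ']

/-! ### Deleting the branch vertex `0` -/

/-- The edge of the subdivided graph charged to a given vertex. -/
def charge (p : ℕ) : Fin 5 ⊕ K5Edge × Fin p → Sym2 (Fin 5 ⊕ K5Edge × Fin p)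
  | Sum.inl i =>
    if i = 1 then s(pathV p ⟨(1, 4), by decide⟩ 0, pathV p ⟨(1, 4), by decide⟩ 1)
    else if i = 2 then s(pathV p ⟨(1, 2), by decide⟩ p, pathV p ⟨(1, 2), by decide⟩ (p + 1))
    else if i = 3 then s(pathV p ⟨(2, 3), by decide⟩ p, pathV p ⟨(2, 3), by decide⟩ (p + 1))
    else s(pathV p ⟨(3, 4), by decide⟩ p, pathV p ⟨(3, 4), by decide⟩ (p + 1))
  | Sum.inr (e, t) =>
    if e.val.1 = 0 ∨ e.val = (1, 4) then s(pathV p e (t + 1), pathV p e (t + 2))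
    else s(pathV p e t, pathV p e (t + 1))

lemma charge_spec (p : ℕ) (e : K5Edge) (t : ℕ) (ht : t ≤ p)
    (h0 : pathV p e t ≠ Sum.inl 0) :
    charge p (pathV p e t) = s(pathV p e t, pathV p e (t + 1)) ∨
    charge p (pathV p e (t + 1)) = s(pathV p e t, pathV p e (t + 1)) ∨
    s(pathV p e t, pathV p e (t + 1)) =
      s(pathV p ⟨(1, 3), by decide⟩ p, pathV p ⟨(1, 3), by decide⟩ (p + 1)) ∨
    s(pathV p e t, pathV p e (t + 1)) =
      s(pathV p ⟨(2, 4), by decide⟩ p, pathV p ⟨(2, 4), by decide⟩ (p + 1)) := by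
  by_cases hc : e.val.1 = 0 ∨ e.val = (1, 4)
  · left
    rcases Nat.eq_zero_or_pos t with rfl | hpos
    · rcases hc with hc | hc
      · rw [pathV_zero, hc] at h0
        exact absurd rfl h0
      · obtain ⟨q, hq⟩ := e
        obtain rfl : q = (1, 4) := hc
        rw [pathV_zero]
        simp [charge, pathV_zero]
    · obtain ⟨s, rfl⟩ : ∃ s, t = s + 1 := ⟨t - 1, by omega⟩
      conv_lhs => rw [pathV_succ' p e s (by omega)]
      simp only [charge, if_pos hc]
  · right
    rcases Nat.lt_or_ge t p with h | h
    · left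
      conv_lhs => rw [pathV_succ' p e t h]
      simp only [charge, if_neg hc]
    · obtain rfl : t = p := by omega
      obtain ⟨q, hq⟩ := e
      have hq' : q = (1, 2) ∨ q = (1, 3) ∨ q = (2, 3) ∨ q = (2, 4) ∨ q = (3, 4) := by
        simp only at hc
        clear h0 ht h
        revert q
        decide
      rcases hq' with rfl | rfl | rfl | rfl | rfl
      · left
        conv_lhs => rw [pathV_last]
        simp [charge]
      · exact Or.inr (Or.inl rfl)
      · left
        conv_lhs => rw [pathV_last]
        simp [charge]
      · exact Or.inr (Or.inr rfl)
      · left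
        conv_lhs => rw [pathV_last]
        simp [charge]

lemma sparse_delete (p : ℕ) (hp : 3 ≤ p) :
    Sparse ((SubdividedK5 p).induce {x | x ≠ Sum.inl 0}) := by
  classical
  intro U F hF
  have hsub : F.image (Sym2.map Subtype.val) ⊆
      (U.image (fun x => charge p x.1)) ∪
      {s(pathV p ⟨(1, 3), by decide⟩ p, pathV p ⟨(1, 3), by decide⟩ (p + 1)),
        s(pathV p ⟨(2, 4), by decide⟩ p, pathV p ⟨(2, 4), by decide⟩ (p + 1))} := by
    intro e' he'
    obtain ⟨e, he, rfl⟩ := Finset.mem_image.1 he'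
    obtain ⟨h1, h2⟩ := hF e he
    induction e with
    | _ a b =>
      have ha := h2 a (by simp)
      have hb := h2 b (by simp)
      have hab : (SubdividedK5 p).Adj a.1 b.1 := h1
      have main : ∀ a b : {x : Fin 5 ⊕ K5Edge × Fin p | x ≠ Sum.inl 0}, a ∈ U → b ∈ U →
          ∀ e t, t ≤ p → a.1 = pathV p e t → b.1 = pathV p e (t + 1) →
          s(a.1, b.1) ∈ (U.image (fun x => charge p x.1)) ∪
      {s(pathV p ⟨(1, 3), by decide⟩ p, pathV p ⟨(1, 3), by decide⟩ (p + 1)),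
        s(pathV p ⟨(2, 4), by decide⟩ p, pathV p ⟨(2, 4), by decide⟩ (p + 1))} := by
        intro a b ha hb e t ht hat hbt
        have := charge_spec p e t ht (hat ▸ a.2)
        rw [← hat, ← hbt] at this
        rw [Finset.mem_union]
        rcases this with h | h | h | h
        · exact Or.inl (Finset.mem_image.2 ⟨a, ha, h⟩)
        · exact Or.inl (Finset.mem_image.2 ⟨b, hb, h⟩)
        · right; rw [h]; simp
        · right; rw [h]; simp
      rw [Sym2.map_mk]
      obtain ⟨e, t, ht, ⟨h3, h4⟩ | ⟨h3, h4⟩⟩ := adj_iff_pathV p hp _ _ hab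
      · exact main a b ha hb e t ht h3 h4
      · rw [Sym2.eq_swap (a := a.1)]
        exact main b a hb ha e t ht h3 h4
  have h := Finset.card_le_card hsub
  rw [Finset.card_image_of_injective _ (Sym2.map.injective Subtype.val_injective)] at h
  refine h.trans ((Finset.card_union_le _ _).trans ?_)
  exact Nat.add_le_add Finset.card_image_le Finset.card_le_two

/-! ### Building a `K₅` minor from a partition into connected classes -/

/-- All fibres of `g` are connected in `G` (expressed by two-valued functions). -/
def FibConn {V X : Type} (G : SimpleGraph V) (g : V → X) : Prop :=
  ∀ ψ : V → Prop, (∀ a b, G.Adj a b → g a = g b → (ψ a ↔ ψ b)) →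
    ∀ a b, g a = g b → (ψ a ↔ ψ b)

lemma hasMinor_K5_of_fibConn (n : ℕ) : ∀ (A : FinGraph), Nat.card A.V = n →
    ∀ g : A.V → Fin 5, Function.Surjective g → FibConn A.G g →
    (∀ i j, i ≠ j → ∃ a b, g a = i ∧ g b = j ∧ A.G.Adj a b) → HasMinor A K5 := by
  classical
  induction n with
  | zero =>
    intro A hA g hg _ _
    obtain ⟨a, -⟩ := hg 0
    have : Nonempty A.V := ⟨a⟩
    exact absurd hA (Nat.card_pos).ne'
  | succ n ih =>
    intro A hA g hg hconn hadj
    by_cases hex : ∃ u v, A.G.Adj u v ∧ g u = g v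
    · obtain ⟨u, v, huv, hguv⟩ := hex
      have hne : u ≠ v := huv.ne
      let f : A.V → {x : A.V // x ≠ v} := fun x => if h : x = v then ⟨u, hne⟩ else ⟨x, h⟩
      have hfv : f v = ⟨u, hne⟩ := by simp [f]
      have hfn : ∀ x (h : x ≠ v), f x = ⟨x, h⟩ := fun x h => by simp [f, h]
      have hgf : ∀ x, g (f x).1 = g x := by
        intro x
        by_cases h : x = v
        · rw [h, hfv, hguv]
        · rw [hfn x h]
      have hfs : Function.Surjective f := fun x => ⟨x.1, hfn x.1 x.2⟩
      let H : SimpleGraph {x : A.V // x ≠ v} :=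
        { Adj := fun x y => x ≠ y ∧ ∃ a b, f a = x ∧ f b = y ∧ A.G.Adj a b
          symm := ⟨fun x y ⟨h, a, b, h1, h2, h3⟩ => ⟨h.symm, b, a, h2, h1, h3.symm⟩⟩
          loopless := ⟨fun x h => h.1 rfl⟩ }
      have hstep : MinorStep A (FinGraph.of _ H) := by
        refine Or.inl ⟨u, v, huv, f, ?_, hfs, ?_, fun x y => Iff.rfl⟩
        · rw [hfv, hfn u hne]
        · intro a b hab hfab
          by_cases ha : a = v <;> by_cases hb : b = v
          · exact absurd (ha.trans hb.symm) hab
          · rw [ha, hfv, hfn b hb] at hfab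
            exact Or.inr ⟨ha, (congrArg Subtype.val hfab).symm⟩
          · rw [hb, hfv, hfn a ha] at hfab
            exact Or.inl ⟨congrArg Subtype.val hfab, hb⟩
          · rw [hfn a ha, hfn b hb] at hfab
            exact absurd (congrArg Subtype.val hfab) hab
      have hcard : Nat.card (FinGraph.of _ H).V = n := by
        show Nat.card {x : A.V // x ≠ v} = n
        have := Fintype.ofFinite A.V
        rw [Nat.card_eq_fintype_card] at hA ⊢
        rw [Fintype.card_subtype_compl, hA]
        simp
      obtain ⟨C, hC, hiso⟩ := ih (FinGraph.of _ H) hcard (fun x => g x.1)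
        (fun i => by
          obtain ⟨a, ha⟩ := hg i
          exact ⟨f a, (hgf a).trans ha⟩)
        (by
          intro ψ hψ x y hxy
          have := hconn (fun a => ψ (f a)) (by
            intro a b hab hgab
            by_cases hfab : f a = f b
            · rw [hfab]
            · exact hψ _ _ ⟨hfab, a, b, rfl, rfl, hab⟩ (by
                show g (f a).1 = g (f b).1
                rw [hgf, hgf, hgab])) x.1 y.1 hxy
          rwa [hfn x.1 x.2, hfn y.1 y.2] at this)
        (by
          intro i j hij
          obtain ⟨a, b, ha, hb, hab⟩ := hadj i j hij
          refine ⟨f a, f b, (hgf a).trans ha, (hgf b).trans hb, ?_, a, b, rfl, rfl, hab⟩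
          intro h
          apply hij
          rw [← ha, ← hb, ← hgf a, ← hgf b, h])
      exact ⟨C, Relation.ReflTransGen.head hstep hC, hiso⟩
    · push Not at hex
      have hinj : Function.Injective g := by
        intro a b hab
        have := hconn (fun x => x = a) (fun x y hxy h => absurd h (hex x y hxy)) a b hab
        exact (this.1 rfl).symm
      refine ⟨A, Relation.ReflTransGen.refl, ⟨⟨Equiv.ofBijective g ⟨hinj, hg⟩, ?_⟩⟩⟩
      intro a b
      show (⊤ : SimpleGraph (Fin 5)).Adj (g a) (g b) ↔ _
      rw [SimpleGraph.top_adj]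
      constructor
      · intro h
        obtain ⟨a', b', ha, hb, hab⟩ := hadj _ _ h
        rwa [hinj ha, hinj hb] at hab
      · exact hex a b

/-! ### Sequences of contractions -/

/-- `f` exhibits `H` as the result of `n` contractions of `G`. -/
structure ContrMap {V W : Type} (G : SimpleGraph V) (H : SimpleGraph W) (n : ℕ)
    (f : V → W) : Prop where
  surj : Function.Surjective f
  adj : ∀ a b, G.Adj a b → f a ≠ f b → H.Adj (f a) (f b)
  lift : ∀ x y, H.Adj x y → ∃ a b, f a = x ∧ f b = y ∧ G.Adj a b
  card : Nat.card V ≤ Nat.card W + n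
  conn : FibConn G f

lemma ContrMap.step {V : Type} {G : SimpleGraph V} {A B : FinGraph} {n : ℕ} {f : V → A.V}
    (hf : ContrMap G A.G n f) (h : ContractionStep A B) :
    ∃ f' : V → B.V, ContrMap G B.G (n + 1) f' := by
  classical
  obtain ⟨u, v, huv, c, hcuv, hcs, hcinj, hcadj⟩ := h
  refine ⟨c ∘ f, hcs.comp hf.surj, ?_, ?_, ?_, ?_⟩
  · intro a b hab hne
    rw [hcadj]
    refine ⟨hne, f a, f b, rfl, rfl, hf.adj a b hab ?_⟩
    intro h
    exact hne (congrArg c h)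
  · intro x y hxy
    rw [hcadj] at hxy
    obtain ⟨-, a, b, rfl, rfl, hab⟩ := hxy
    obtain ⟨a', b', rfl, rfl, hab'⟩ := hf.lift _ _ hab
    exact ⟨a', b', rfl, rfl, hab'⟩
  · have h1 := hf.card
    have h2 : Nat.card A.V ≤ Nat.card B.V + 1 := by
      have hinj : Function.Injective
          (fun x : A.V => if x = v then (none : Option B.V) else some (c x)) := by
        intro a b hab
        by_contra hne
        by_cases ha : a = v <;> by_cases hb : b = v <;> simp [ha, hb] at hab
        · exact hne (ha.trans hb.symm)
        · rcases hcinj a b hne hab with ⟨_, h⟩ | ⟨h, _⟩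
          · exact hb h
          · exact ha h
      have := Nat.card_le_card_of_injective _ hinj
      rwa [Finite.card_option] at this
    omega
  · intro ψ hψ
    have h1 : ∀ a b, f a = f b → (ψ a ↔ ψ b) :=
      hf.conn ψ (fun a b hab hfab => hψ a b hab (congrArg c hfab))
    obtain ⟨a₀, b₀, ha₀, hb₀, hab₀⟩ := hf.lift u v huv
    have h2 : ψ a₀ ↔ ψ b₀ := hψ a₀ b₀ hab₀ (by simp [ha₀, hb₀, hcuv])
    intro a b hab
    by_cases hfab : f a = f b
    · exact h1 a b hfab
    · rcases hcinj _ _ hfab hab with ⟨ha, hb⟩ | ⟨ha, hb⟩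
      · rw [h1 a a₀ (ha.trans ha₀.symm), h1 b b₀ (hb.trans hb₀.symm), h2]
      · rw [h1 a b₀ (ha.trans hb₀.symm), h1 b a₀ (hb.trans ha₀.symm), h2]

lemma exists_contrMap {V : Type} [Finite V] (G : SimpleGraph V) (c : ℕ → FinGraph)
    (h0 : c 0 = FinGraph.of V G) (n : ℕ) :
    (∀ i, i < n → ContractionStep (c i) (c (i + 1))) →
    ∃ f : V → (c n).V, ContrMap G (c n).G n f := by
  induction n with
  | zero =>
    intro _
    rw [h0]
    exact ⟨id, Function.surjective_id, fun a b h _ => h, fun a b h => ⟨a, b, rfl, rfl, h⟩,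
      le_rfl, fun ψ _ a b hab => by rw [show a = b from hab]⟩
  | succ n ih =>
    intro hs
    obtain ⟨f, hf⟩ := ih (fun i hi => hs i (by omega))
    exact hf.step (hs n (by omega))

lemma hasMinor_of_contrMap (p : ℕ) (hp : 3 ≤ p) (B : FinGraph) (n : ℕ) (hn : n ≤ p - 2)
    (f : Fin 5 ⊕ K5Edge × Fin p → B.V) (hf : ContrMap (SubdividedK5 p) B.G n f) :
    HasMinor B K5 := by
  classical
  -- on every path there is an edge that is not contracted
  have hcut : ∀ e : K5Edge, ∃ s, s ≤ p ∧ f (pathV p e s) ≠ f (pathV p e (s + 1)) := by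
    intro e
    by_contra hcon
    push Not at hcon
    have hconst : ∀ t, t ≤ p + 1 → f (pathV p e t) = f (pathV p e 0) := by
      intro t
      induction t with
      | zero => intro _; rfl
      | succ t ih => intro ht; rw [← hcon t (by omega), ih (by omega)]
    let S : Finset (Fin 5 ⊕ K5Edge × Fin p) :=
      (Finset.range (p + 1)).image (fun t => pathV p e (t + 1))
    have hS : S.card = p + 1 := by
      rw [Finset.card_image_of_injOn, Finset.card_range]
      intro a ha b hb hab
      simp only [Finset.coe_range, Set.mem_Iio] at ha hb
      have := pathV_injOn p e (a + 1) (b + 1) (by omega) (by omega) hab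
      omega
    have hsurj : Function.Surjective (fun x : {x // x ∉ S} => f x.1) := by
      intro y
      obtain ⟨x, rfl⟩ := hf.surj y
      by_cases hx : x ∈ S
      · obtain ⟨t, ht, rfl⟩ := Finset.mem_image.1 hx
        rw [Finset.mem_range] at ht
        refine ⟨⟨pathV p e 0, ?_⟩, (hconst (t + 1) (by omega)).symm⟩
        intro h
        obtain ⟨r, hr, hr'⟩ := Finset.mem_image.1 h
        rw [Finset.mem_range] at hr
        have := pathV_injOn p e (r + 1) 0 (by omega) (by omega) hr'
        omega
      · exact ⟨⟨x, hx⟩, rfl⟩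
    have h1 := Nat.card_le_card_of_surjective _ hsurj
    have h2 := hf.card
    rw [Nat.card_eq_fintype_card (α := {x // x ∉ S}), Fintype.card_subtype_compl, Fintype.card_coe, hS] at h1
    have h3 := S.card_le_univ
    rw [hS] at h3
    rw [Nat.card_eq_fintype_card (α := Fin 5 ⊕ K5Edge × Fin p)] at h2
    omega
  choose s hsp hs using hcut
  let φ : Fin 5 ⊕ K5Edge × Fin p → Fin 5 := fun x =>
    match x with
    | Sum.inl i => i
    | Sum.inr (e, t) => if (t : ℕ) + 1 ≤ s e then e.val.1 else e.val.2
  have hφ : ∀ e t, t ≤ p + 1 → φ (pathV p e t) = if t ≤ s e then e.val.1 else e.val.2 := by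
    intro e t ht
    rcases Nat.eq_zero_or_pos t with rfl | h0
    · rw [pathV_zero]
      simp [φ]
    · obtain ⟨r, rfl⟩ : ∃ r, t = r + 1 := ⟨t - 1, by omega⟩
      rcases Nat.lt_or_ge r p with h | h
      · rw [pathV_succ' p e r h]
      · obtain rfl : r = p := by omega
        rw [pathV_last, if_neg (by have := hsp e; omega)]
  have hφe : ∀ a b, (SubdividedK5 p).Adj a b → f a = f b → φ a = φ b := by
    have main : ∀ e t, t ≤ p → f (pathV p e t) = f (pathV p e (t + 1)) →
        φ (pathV p e t) = φ (pathV p e (t + 1)) := by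
      intro e t ht h
      have hne : t ≠ s e := by
        rintro rfl
        exact hs e h
      rw [hφ e t (by omega), hφ e (t + 1) (by omega)]
      by_cases h' : t ≤ s e
      · rw [if_pos h', if_pos (by omega)]
      · rw [if_neg h', if_neg (by omega)]
    intro a b hab hfab
    obtain ⟨e, t, ht, ⟨rfl, rfl⟩ | ⟨rfl, rfl⟩⟩ := adj_iff_pathV p hp a b hab
    · exact main e t ht hfab
    · exact (main e t ht hfab.symm).symm
  have hφf : ∀ a b, f a = f b → φ a = φ b := by
    intro a b hab
    exact ((hf.conn (fun x => φ a = φ x)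
      (fun x y hxy hfxy => by rw [hφe x y hxy hfxy]) a b hab).1 rfl)
  choose r hr using hf.surj
  let g : B.V → Fin 5 := fun x => φ (r x)
  have hg : ∀ a, g (f a) = φ a := fun a => hφf _ _ (hr (f a))
  refine hasMinor_K5_of_fibConn _ B rfl g (fun i => ⟨f (Sum.inl i), hg _⟩) ?_ ?_
  · intro ψ hψ
    have hψ' : ∀ a b, (SubdividedK5 p).Adj a b → φ a = φ b → (ψ (f a) ↔ ψ (f b)) := by
      intro a b hab hab'
      by_cases h : f a = f b
      · rw [h]
      · exact hψ _ _ (hf.adj a b hab h) (by rw [hg, hg, hab'])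
    have hlow : ∀ e t, t ≤ s e → (ψ (f (pathV p e t)) ↔ ψ (f (Sum.inl e.val.1))) := by
      intro e t
      induction t with
      | zero => intro _; rfl
      | succ t ih =>
        intro ht
        have := hsp e
        rw [← ih (by omega)]
        refine (hψ' _ _ (pathV_adj p hp e t (by omega)) ?_).symm
        rw [hφ e t (by omega), hφ e (t + 1) (by omega), if_pos (by omega), if_pos (by omega)]
    have hhigh : ∀ e k, k ≤ p → s e < p + 1 - k →
        (ψ (f (pathV p e (p + 1 - k))) ↔ ψ (f (Sum.inl e.val.2))) := by
      intro e k
      induction k with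
      | zero => intro _ _; rw [Nat.sub_zero, pathV_last]
      | succ k ih =>
        intro hk hk'
        rw [← ih (by omega) (by omega)]
        have h1 : p + 1 - k = (p + 1 - (k + 1)) + 1 := by omega
        rw [h1]
        refine hψ' _ _ (pathV_adj p hp e _ (by omega)) ?_
        rw [hφ e _ (by omega), hφ e _ (by omega), if_neg (by omega), if_neg (by omega)]
    have hall : ∀ a, ψ (f a) ↔ ψ (f (Sum.inl (φ a))) := by
      rintro (i | ⟨e, t⟩)
      · rfl
      · have ht := t.2
        rw [← pathV_succ, hφ e _ (by omega)]
        by_cases h : (t : ℕ) + 1 ≤ s e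
        · rw [if_pos h]
          exact hlow e _ h
        · rw [if_neg h]
          have h1 := hhigh e (p - t) (by omega) (by omega)
          rwa [show p + 1 - (p - (t : ℕ)) = t + 1 by omega] at h1
    intro x y hxy
    have hx := hall (r x)
    have hy := hall (r y)
    rw [hr] at hx hy
    rw [hx, hy, show φ (r x) = φ (r y) from hxy]
  · have main : ∀ i j : Fin 5, i < j → ∃ a b, g a = i ∧ g b = j ∧ B.G.Adj a b := by
      intro i j hij
      let e : K5Edge := ⟨(i, j), hij⟩
      have := hsp e
      refine ⟨f (pathV p e (s e)), f (pathV p e (s e + 1)), ?_, ?_,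
        hf.adj _ _ (pathV_adj p hp e _ (hsp e)) (hs e)⟩
      · rw [hg, hφ e _ (by omega), if_pos le_rfl]
      · rw [hg, hφ e _ (by omega), if_neg (by omega)]
    intro i j hij
    rcases lt_or_gt_of_ne hij with h | h
    · exact main i j h
    · obtain ⟨a, b, ha, hb, hab⟩ := main j i h
      exact ⟨b, a, hb, ha, hab.symm⟩

/-- For `p ≥ 3`, the graph obtained from `K₅` by subdividing every edge
exactly `p` times has a vertex whose deletion gives a planar graph, yet it cannot be
contracted to a planar graph by fewer than `p − 1` edge contractions. -/
theorem subdividedK5_vertex_deletion_planar_but_many_contractions_needed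
    (p : ℕ) (hp : 3 ≤ p) :
    ∃ v : Fin 5 ⊕ K5Edge × Fin p,
      (FinGraph.of ↥{x | x ≠ v} ((SubdividedK5 p).induce {x | x ≠ v})).IsPlanar ∧
      ¬ ContractiblePlanar (p - 2) (FinGraph.of _ (SubdividedK5 p)) := by
  refine ⟨Sum.inl 0, ⟨fun h => ?_, fun h => ?_⟩, ?_⟩
  · exact not_sparse_K5 (Sparse.hasMinor (sparse_delete p hp) h)
  · exact not_sparse_K33 (Sparse.hasMinor (sparse_delete p hp) h)
  · rintro ⟨B, ⟨n, hn, c, h0, rfl, hc⟩, hB, -⟩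
    obtain ⟨f, hf⟩ := exists_contrMap (SubdividedK5 p) c h0 n hc
    exact hB (hasMinor_of_contrMap p hp _ n hn f hf)
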